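/- Under the zeroth-order estimator setup, suppose f is L_f-smooth and the random direction u satisfies E_u[u uᵀ] = I_d and E_u[‖⟨g,u⟩u‖_p²] ≤ S_p‖g‖₂² for all g ∈ ℝ^d. Then for all x, y the smoothed gradient g_ν(x) = E_u[((f(x+νu) − f(x))/ν)·u] satisfies ‖g_ν(y) − g_ν(x)‖_p² ≤ (3ν²L_f²/2)·E_u[‖u‖₂⁶] + 3 S_p L_f² ‖y − x‖₂². -/

import Mathlib

open MeasureTheory Finset
open scoped RealInnerProductSpace

/-- The ℓ_p norm on ℝ^d. -/
noncomputable def lpNorm {d : ℕ} (p : ℝ) (x : EuclideanSpace ℝ (Fin d)) : ℝ :=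
  (∑ i, |x i| ^ p) ^ (1 / p)

lemma lpNorm_le_norm {d : ℕ} {p : ℝ} (hp : 2 ≤ p) (x : EuclideanSpace ℝ (Fin d)) :
    lpNorm p x ≤ ‖x‖ := by
  have hp0 : 0 < p := by linarith
  have hsum : ∑ i, |x i| ^ p ≤ ‖x‖ ^ p := by
    have hsplit : ∀ a : ℝ, 0 ≤ a → a ^ p = a ^ 2 * a ^ (p - 2) := fun a ha => by
      rw [← Real.rpow_natCast a 2, ← Real.rpow_add_of_nonneg ha (by norm_num) (by linarith)]
      norm_num
    calc ∑ i, |x i| ^ p ≤ ∑ i, |x i| ^ 2 * ‖x‖ ^ (p - 2) := by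
          refine Finset.sum_le_sum fun i _ => ?_
          rw [hsplit _ (abs_nonneg _)]
          have hi : |x i| ≤ ‖x‖ := PiLp.norm_apply_le x i
          gcongr
      _ = ‖x‖ ^ p := by
          rw [← Finset.sum_mul, hsplit _ (norm_nonneg _), EuclideanSpace.norm_sq_eq]
          simp [Real.norm_eq_abs]
  calc lpNorm p x ≤ (‖x‖ ^ p) ^ (1 / p) :=
        Real.rpow_le_rpow (Finset.sum_nonneg fun i _ => by positivity) hsum (by positivity)
    _ = ‖x‖ := by
        rw [← Real.rpow_mul (norm_nonneg _), mul_one_div_cancel hp0.ne', Real.rpow_one]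

lemma lpNorm_nonneg {d : ℕ} (p : ℝ) (x : EuclideanSpace ℝ (Fin d)) : 0 ≤ lpNorm p x :=
  Real.rpow_nonneg (Finset.sum_nonneg fun i _ => by positivity) _

lemma abs_apply_le_lpNorm {d : ℕ} {p : ℝ} (hp : 0 < p) (x : EuclideanSpace ℝ (Fin d))
    (i : Fin d) : |x i| ≤ lpNorm p x := by
  calc |x i| = (|x i| ^ p) ^ (1 / p) := by
        rw [← Real.rpow_mul (abs_nonneg _), mul_one_div_cancel hp.ne', Real.rpow_one]
    _ ≤ lpNorm p x := by
        refine Real.rpow_le_rpow (by positivity) ?_ (by positivity)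
        exact Finset.single_le_sum (f := fun i => |x i| ^ p) (fun i _ => by positivity)
          (Finset.mem_univ i)

lemma measurable_lpNorm {d : ℕ} (p : ℝ) :
    Measurable (lpNorm p : EuclideanSpace ℝ (Fin d) → ℝ) := by
  unfold _root_.lpNorm
  refine Measurable.pow_const (Finset.measurable_fun_sum _ fun i _ => ?_) _
  have hi : Measurable fun x : EuclideanSpace ℝ (Fin d) => x i := by fun_prop
  exact (continuous_abs.measurable.comp hi).pow_const p

lemma sq_integral_le_integral_sq {Ω : Type*} [MeasurableSpace Ω] {μ : Measure Ω}
    [IsProbabilityMeasure μ] {X : Ω → ℝ} (hX : Integrable X μ)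
    (hX2 : Integrable (fun ω => X ω ^ 2) μ) : (∫ ω, X ω ∂μ) ^ 2 ≤ ∫ ω, X ω ^ 2 ∂μ := by
  set m := ∫ ω, X ω ∂μ with hm
  have h : ∫ ω, (2 * m * X ω - m ^ 2) ∂μ ≤ ∫ ω, X ω ^ 2 ∂μ :=
    integral_mono ((hX.const_mul _).sub (integrable_const _)) hX2 fun ω => by
      nlinarith [sq_nonneg (X ω - m)]
  rw [integral_sub (hX.const_mul _) (integrable_const _), integral_const_mul, ← hm] at h
  simp at h
  linarith

/-- The descent lemma: the first-order Taylor error of an `L`-smooth function is at most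
`L / 2 * ‖h‖ ^ 2`. -/
lemma abs_sub_sub_inner_gradient_le {E : Type*} [NormedAddCommGroup E] [InnerProductSpace ℝ E]
    [CompleteSpace E] {f : E → ℝ} {f' : E → E} {L : ℝ}
    (hf : ∀ x, HasGradientAt f (f' x) x) (hL : ∀ x y, ‖f' x - f' y‖ ≤ L * ‖x - y‖) (x h : E) :
    |f (x + h) - f x - ⟪f' x, h⟫| ≤ L / 2 * ‖h‖ ^ 2 := by
  have hφ : ∀ t : ℝ, HasDerivAt (fun t : ℝ => f (x + t • h) - f x - t * ⟪f' x, h⟫)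
      (⟪f' (x + t • h) - f' x, h⟫) t := fun t => by
    have hline : HasDerivAt (fun t : ℝ => x + t • h) h t := by
      simpa using ((hasDerivAt_id t).smul_const h).const_add x
    have hcomp := (hf (x + t • h)).hasFDerivAt.comp_hasDerivAt t hline
    have := (hcomp.sub_const (f x)).sub ((hasDerivAt_id t).mul_const ⟪f' x, h⟫)
    exact this.congr_deriv (by simp [inner_sub_left])
  have hB : ∀ t : ℝ, HasDerivAt (fun t : ℝ => L / 2 * ‖h‖ ^ 2 * t ^ 2) (L * ‖h‖ ^ 2 * t) t :=
    fun t => by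
      refine ((hasDerivAt_pow 2 t).const_mul (L / 2 * ‖h‖ ^ 2)).congr_deriv ?_
      push_cast
      ring
  have key := image_norm_le_of_norm_deriv_right_le_deriv_boundary (a := 0) (b := 1)
    (f := fun t : ℝ => f (x + t • h) - f x - t * ⟪f' x, h⟫)
    (fun t _ => (hφ t).continuousAt.continuousWithinAt) (fun t _ => (hφ t).hasDerivWithinAt)
    (by simp) hB (fun t ht => by
      calc ‖⟪f' (x + t • h) - f' x, h⟫‖ ≤ ‖f' (x + t • h) - f' x‖ * ‖h‖ := norm_inner_le_norm _ _
        _ ≤ L * ‖x + t • h - x‖ * ‖h‖ := by gcongr; exact hL _ _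
        _ = L * ‖h‖ ^ 2 * t := by
          rw [add_sub_cancel_left, norm_smul, Real.norm_of_nonneg ht.1]
          ring)
    (Set.right_mem_Icc.2 zero_le_one)
  simpa using key

section Isotropic

variable {d : ℕ} {Ω : Type*} [MeasurableSpace Ω] {μ : Measure Ω}
  {u : Ω → EuclideanSpace ℝ (Fin d)}

lemma integrable_inner_smul (hu : Measurable u) (h2 : Integrable (fun ω => ‖u ω‖ ^ 2) μ)
    (g : EuclideanSpace ℝ (Fin d)) : Integrable (fun ω => (⟪g, u ω⟫ : ℝ) • u ω) μ := by
  have hm : Measurable fun ω => (⟪g, u ω⟫ : ℝ) • u ω := by fun_prop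
  refine (h2.const_mul ‖g‖).mono' hm.aestronglyMeasurable (ae_of_all _ fun ω => ?_)
  rw [norm_smul, sq, ← mul_assoc]
  gcongr
  exact norm_inner_le_norm _ _

lemma integral_inner_smul_eq (hu : Measurable u) (h2 : Integrable (fun ω => ‖u ω‖ ^ 2) μ)
    (hId : ∀ i j, (∫ ω, u ω i * u ω j ∂μ) = if i = j then (1 : ℝ) else 0)
    (g : EuclideanSpace ℝ (Fin d)) : ∫ ω, (⟪g, u ω⟫ : ℝ) • u ω ∂μ = g := by
  have hint : ∀ i j, Integrable (fun ω => u ω i * u ω j) μ := fun i j => by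
    have hm : Measurable fun ω => u ω i * u ω j := by fun_prop
    refine h2.mono' hm.aestronglyMeasurable (ae_of_all _ fun ω => ?_)
    rw [norm_mul, sq]
    gcongr <;> exact PiLp.norm_apply_le _ _
  ext i
  have hcoord := (EuclideanSpace.proj (𝕜 := ℝ) i).integral_comp_comm (integrable_inner_smul hu h2 g)
  calc (∫ ω, (⟪g, u ω⟫ : ℝ) • u ω ∂μ) i = ∫ ω, ((⟪g, u ω⟫ : ℝ) • u ω) i ∂μ := hcoord.symm
    _ = ∫ ω, ∑ j, g j * (u ω j * u ω i) ∂μ := by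
        refine integral_congr_ae (ae_of_all _ fun ω => ?_)
        simp only [PiLp.smul_apply, smul_eq_mul, PiLp.inner_apply, Finset.sum_mul]
        refine Finset.sum_congr rfl fun j _ => ?_
        simp
        ring
    _ = g i := by
        rw [integral_finsetSum _ fun j _ => (hint j i).const_mul _]
        simp [integral_const_mul, hId]

lemma one_le_of_integral_lpNorm_sq_le [IsProbabilityMeasure μ] (hd : 1 ≤ d) {p S : ℝ} (hp : 2 ≤ p) (hu : Measurable u)
    (h4 : Integrable (fun ω => ‖u ω‖ ^ 4) μ)
    (hId : ∀ i j, (∫ ω, u ω i * u ω j ∂μ) = if i = j then (1 : ℝ) else 0)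
    (hS : ∀ g : EuclideanSpace ℝ (Fin d),
      (∫ ω, (lpNorm p ((⟪g, u ω⟫ : ℝ) • u ω)) ^ 2 ∂μ) ≤ S * ‖g‖ ^ 2) : 1 ≤ S := by
  let i : Fin d := ⟨0, hd⟩
  let e : EuclideanSpace ℝ (Fin d) := EuclideanSpace.single i 1
  have he : ‖e‖ = 1 := by simp [e]
  have hinner : ∀ ω, (⟪e, u ω⟫ : ℝ) = u ω i := fun ω => by
    simp [e, EuclideanSpace.inner_single_left]
  have hi : ∀ ω, |u ω i| ≤ ‖u ω‖ := fun ω => PiLp.norm_apply_le (u ω) i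
  have hsq : Integrable (fun ω => u ω i * u ω i) μ := by
    have hm : Measurable fun ω => u ω i * u ω i := by fun_prop
    refine (integrable_norm_pow_of_le hu.aestronglyMeasurable (by norm_num : 2 ≤ 4) h4).mono'
      hm.aestronglyMeasurable (ae_of_all _ fun ω => ?_)
    rw [norm_mul, sq]
    gcongr <;> exact hi ω
  have hlp : Integrable (fun ω => (lpNorm p ((⟪e, u ω⟫ : ℝ) • u ω)) ^ 2) μ := by
    have hm : Measurable fun ω => (⟪e, u ω⟫ : ℝ) • u ω := by fun_prop
    refine h4.mono' (((measurable_lpNorm p).comp hm).pow_const 2).aestronglyMeasurable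
      (ae_of_all _ fun ω => ?_)
    rw [Real.norm_of_nonneg (by positivity)]
    calc lpNorm p ((⟪e, u ω⟫ : ℝ) • u ω) ^ 2 ≤ ‖(⟪e, u ω⟫ : ℝ) • u ω‖ ^ 2 := by
          gcongr
          · exact lpNorm_nonneg _ _
          · exact lpNorm_le_norm hp _
      _ ≤ (‖u ω‖ * ‖u ω‖) ^ 2 := by
          rw [norm_smul, hinner]
          gcongr
          exact hi ω
      _ = ‖u ω‖ ^ 4 := by ring
  have hle : ∀ ω, (u ω i * u ω i) ^ 2 ≤ (lpNorm p ((⟪e, u ω⟫ : ℝ) • u ω)) ^ 2 := fun ω => by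
    rw [sq_le_sq, abs_of_nonneg (lpNorm_nonneg _ _)]
    have := abs_apply_le_lpNorm (by linarith : 0 < p) ((⟪e, u ω⟫ : ℝ) • u ω) i
    rw [PiLp.smul_apply, smul_eq_mul, hinner] at this
    rwa [hinner]
  have hsq2 : Integrable (fun ω => (u ω i * u ω i) ^ 2) μ :=
    hlp.mono' (hsq.aestronglyMeasurable.pow 2) (ae_of_all _ fun ω => by
      rw [Real.norm_of_nonneg (by positivity)]
      exact hle ω)
  have h1 := sq_integral_le_integral_sq hsq hsq2
  have h2 := integral_mono hsq2 hlp hle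
  have h3 := hS e
  rw [hId, if_pos rfl] at h1
  rw [he] at h3
  linarith

end Isotropic

section TaylorError

variable {E : Type*} [NormedAddCommGroup E] [InnerProductSpace ℝ E] [CompleteSpace E]
  {f : E → ℝ} {f' : E → E} {L ν : ℝ}

lemma norm_smoothing_error_le (hf : ∀ x, HasGradientAt f (f' x) x)
    (hL : ∀ x y, ‖f' x - f' y‖ ≤ L * ‖x - y‖) (hν : 0 < ν) (x v : E) :
    ‖((f (x + ν • v) - f x) / ν) • v - (⟪f' x, v⟫ : ℝ) • v‖ ≤ L * ν / 2 * ‖v‖ ^ 3 := by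
  have h := abs_sub_sub_inner_gradient_le hf hL x (ν • v)
  rw [inner_smul_right, norm_smul, Real.norm_of_nonneg hν.le] at h
  have hscalar : |(f (x + ν • v) - f x) / ν - ⟪f' x, v⟫| ≤ L * ν / 2 * ‖v‖ ^ 2 := by
    have hdiv : (f (x + ν • v) - f x) / ν - ⟪f' x, v⟫
        = (f (x + ν • v) - f x - ν * ⟪f' x, v⟫) / ν := by
      field_simp
    rw [hdiv, abs_div, abs_of_pos hν, div_le_iff₀ hν]
    linarith
  rw [← sub_smul, norm_smul, Real.norm_eq_abs]
  calc _ ≤ L * ν / 2 * ‖v‖ ^ 2 * ‖v‖ := by gcongr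
    _ = L * ν / 2 * ‖v‖ ^ 3 := by ring

variable [MeasurableSpace E] [BorelSpace E] [SecondCountableTopology E]
  {Ω : Type*} [MeasurableSpace Ω] {μ : Measure Ω} {u : Ω → E}

lemma integrable_smoothing_error (hf : ∀ x, HasGradientAt f (f' x) x)
    (hL : ∀ x y, ‖f' x - f' y‖ ≤ L * ‖x - y‖) (hν : 0 < ν) (hu : Measurable u)
    (h3 : Integrable (fun ω => ‖u ω‖ ^ 3) μ) (x : E) :
    Integrable (fun ω => ((f (x + ν • u ω) - f x) / ν) • u ω - (⟪f' x, u ω⟫ : ℝ) • u ω) μ := by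
  have hfc : Continuous f :=
    continuous_iff_continuousAt.2 fun x => (hf x).hasFDerivAt.continuousAt
  have hm : Measurable fun v => ((f (x + ν • v) - f x) / ν) • v - (⟪f' x, v⟫ : ℝ) • v := by
    refine Continuous.measurable ?_
    fun_prop
  exact (h3.const_mul (L * ν / 2)).mono' (hm.comp hu).aestronglyMeasurable
    (ae_of_all _ fun ω => norm_smoothing_error_le hf hL hν x (u ω))

lemma sq_norm_integral_smoothing_error_le [IsProbabilityMeasure μ]
    (hf : ∀ x, HasGradientAt f (f' x) x)
    (hL : ∀ x y, ‖f' x - f' y‖ ≤ L * ‖x - y‖) (hν : 0 < ν) (hu : Measurable u)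
    (h6 : Integrable (fun ω => ‖u ω‖ ^ 6) μ) (x : E) :
    ‖∫ ω, (((f (x + ν • u ω) - f x) / ν) • u ω - (⟪f' x, u ω⟫ : ℝ) • u ω) ∂μ‖ ^ 2
      ≤ L ^ 2 * ν ^ 2 / 4 * ∫ ω, ‖u ω‖ ^ 6 ∂μ := by
  have h3 : Integrable (fun ω => ‖u ω‖ ^ 3) μ :=
    integrable_norm_pow_of_le hu.aestronglyMeasurable (by norm_num) h6
  have hpow : ∀ ω, (‖u ω‖ ^ 3) ^ 2 = ‖u ω‖ ^ 6 := fun ω => by ring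
  have hle := norm_integral_le_of_norm_le (h3.const_mul (L * ν / 2))
    (ae_of_all μ fun ω => norm_smoothing_error_le hf hL hν x (u ω))
  rw [integral_const_mul] at hle
  have hj : (∫ ω, ‖u ω‖ ^ 3 ∂μ) ^ 2 ≤ ∫ ω, ‖u ω‖ ^ 6 ∂μ := by
    simpa only [hpow] using sq_integral_le_integral_sq h3 (by simpa only [hpow] using h6)
  calc _ ≤ (L * ν / 2 * ∫ ω, ‖u ω‖ ^ 3 ∂μ) ^ 2 := by gcongr
    _ = L ^ 2 * ν ^ 2 / 4 * (∫ ω, ‖u ω‖ ^ 3 ∂μ) ^ 2 := by ring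
    _ ≤ _ := by gcongr

end TaylorError

lemma norm_add_sub_sq_le {E : Type*} [SeminormedAddCommGroup E] (a b c : E) :
    ‖a + c - b‖ ^ 2 ≤ 3 * (‖a‖ ^ 2 + ‖b‖ ^ 2 + ‖c‖ ^ 2) := by
  have h : ‖a + c - b‖ ≤ ‖a‖ + ‖c‖ + ‖b‖ :=
    (norm_sub_le _ _).trans (by gcongr; exact norm_add_le _ _)
  calc ‖a + c - b‖ ^ 2 ≤ (‖a‖ + ‖c‖ + ‖b‖) ^ 2 := by gcongr
    _ ≤ _ := by
      nlinarith [sq_nonneg (‖a‖ - ‖b‖), sq_nonneg (‖a‖ - ‖c‖), sq_nonneg (‖b‖ - ‖c‖)]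

/-- second estimate of Lemma 2.6: Lipschitz-type bound for the smoothed
gradient `g_ν(x) = E_u[((f(x+νu) − f(x))/ν)·u]` in ℓ_p-norm. -/
theorem smoothed_gradient_lipschitz
    {d : ℕ} (hd : 1 ≤ d) {p : ℝ} (hp : 2 ≤ p) {ν Lf Sp : ℝ} (hν : 0 < ν)
    (f : EuclideanSpace ℝ (Fin d) → ℝ)
    (f' : EuclideanSpace ℝ (Fin d) → EuclideanSpace ℝ (Fin d))
    (hdiff : ∀ x, HasGradientAt f (f' x) x)
    (hLf : ∀ x y, ‖f' x - f' y‖ ≤ Lf * ‖x - y‖)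
    {Ω : Type*} [MeasurableSpace Ω] (μu : Measure Ω) [IsProbabilityMeasure μu]
    (u : Ω → EuclideanSpace ℝ (Fin d)) (hu : Measurable u)
    (hmom : Integrable (fun ω => ‖u ω‖ ^ 6) μu)
    (hId : ∀ i j, (∫ ω, u ω i * u ω j ∂μu) = if i = j then (1:ℝ) else 0)
    (hSp : ∀ g : EuclideanSpace ℝ (Fin d),
      (∫ ω, (lpNorm p ((⟪g, u ω⟫ : ℝ) • u ω)) ^ 2 ∂μu) ≤ Sp * ‖g‖ ^ 2)
    (x y : EuclideanSpace ℝ (Fin d)) :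
    (lpNorm p ((∫ ω, ((f (y + ν • u ω) - f y) / ν) • u ω ∂μu)
        - (∫ ω, ((f (x + ν • u ω) - f x) / ν) • u ω ∂μu))) ^ 2
      ≤ 3 * ν ^ 2 * Lf ^ 2 / 2 * (∫ ω, ‖u ω‖ ^ 6 ∂μu)
        + 3 * Sp * Lf ^ 2 * ‖y - x‖ ^ 2 := by
  have h2 : Integrable (fun ω => ‖u ω‖ ^ 2) μu :=
    integrable_norm_pow_of_le hu.aestronglyMeasurable (by norm_num) hmom
  have h3 : Integrable (fun ω => ‖u ω‖ ^ 3) μu :=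
    integrable_norm_pow_of_le hu.aestronglyMeasurable (by norm_num) hmom
  have h4 : Integrable (fun ω => ‖u ω‖ ^ 4) μu :=
    integrable_norm_pow_of_le hu.aestronglyMeasurable (by norm_num) hmom
  have hS := one_le_of_integral_lpNorm_sq_le hd hp hu h4 hId hSp
  have hsplit : ∀ z, ∫ ω, ((f (z + ν • u ω) - f z) / ν) • u ω ∂μu
      = (∫ ω, (((f (z + ν • u ω) - f z) / ν) • u ω - (⟪f' z, u ω⟫ : ℝ) • u ω) ∂μu) + f' z := by
    intro z
    calc _ = ∫ ω, ((((f (z + ν • u ω) - f z) / ν) • u ω - (⟪f' z, u ω⟫ : ℝ) • u ω)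
          + (⟪f' z, u ω⟫ : ℝ) • u ω) ∂μu := by simp only [sub_add_cancel]
      _ = _ := by
        rw [integral_add (integrable_smoothing_error hdiff hLf hν hu h3 z)
          (integrable_inner_smul hu h2 (f' z)), integral_inner_smul_eq hu h2 hId]
  have hx := sq_norm_integral_smoothing_error_le hdiff hLf hν hu hmom x
  have hy := sq_norm_integral_smoothing_error_le hdiff hLf hν hu hmom y
  rw [hsplit x, hsplit y]
  set A := ∫ ω, (((f (y + ν • u ω) - f y) / ν) • u ω - (⟪f' y, u ω⟫ : ℝ) • u ω) ∂μu
  set B := ∫ ω, (((f (x + ν • u ω) - f x) / ν) • u ω - (⟪f' x, u ω⟫ : ℝ) • u ω) ∂μu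
  have hg : ‖f' y - f' x‖ ^ 2 ≤ Sp * (Lf ^ 2 * ‖y - x‖ ^ 2) :=
    calc ‖f' y - f' x‖ ^ 2 ≤ (Lf * ‖y - x‖) ^ 2 := by gcongr; exact hLf y x
      _ = 1 * (Lf ^ 2 * ‖y - x‖ ^ 2) := by ring
      _ ≤ _ := by gcongr
  have habc := norm_add_sub_sq_le A B (f' y - f' x)
  calc lpNorm p (A + f' y - (B + f' x)) ^ 2 ≤ ‖A + f' y - (B + f' x)‖ ^ 2 := by
        gcongr
        · exact lpNorm_nonneg _ _
        · exact lpNorm_le_norm hp _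
    _ = ‖A + (f' y - f' x) - B‖ ^ 2 := by congr 2; abel
    _ ≤ _ := by linarith
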